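/- Let p ≥ 3 be an integer, let f = (f_{i,j}) be an infinite frieze pattern of type Λ_p, and let x_1 < x_2 < ⋯ < x_r be integers each of which is non-saturated and has defect 0, such that no integer strictly between x_1 and x_r other than x_2, …, x_{r−1} is non-saturated. Then r ≤ p − 3. -/

import Mathlib

/-- `lam p = λ_p = 2 cos (π / p)`. -/
noncomputable def lam (p : ℕ) : ℝ := 2 * Real.cos (Real.pi / p)

/-- An infinite frieze pattern. -/
def IsInfFrieze (f : ℤ → ℤ → ℝ) : Prop :=
  (∀ i : ℤ, f i i = 0) ∧
  (∀ i : ℤ, f i (i + 1) = 1) ∧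
  (∀ i j : ℤ, i + 1 ≤ j → 0 < f i j) ∧
  (∀ i j : ℤ, i + 1 ≤ j → f i j * f (i + 1) (j + 1) - f i (j + 1) * f (i + 1) j = 1)

/-- The frieze pattern is of type `Λ_p`. -/
def IsTypeLambda (p : ℕ) (f : ℤ → ℤ → ℝ) : Prop :=
  ∀ i : ℤ, ∃ n : ℕ, 0 < n ∧ f i (i + 2) = n * lam p

/-- `b` is saturated for `f` if it lies strictly below an arc of `Θ(F)`. -/
def Saturated (f : ℤ → ℤ → ℝ) (b : ℤ) : Prop :=
  ∃ i j : ℤ, i < b ∧ b < j ∧ f i j = 1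

/-- `numArcs f b` = number of arcs of `Θ(F)` attached to `b`. -/
noncomputable def numArcs (f : ℤ → ℤ → ℝ) (b : ℤ) : ℕ :=
  ({j : ℤ | j ≤ b - 2 ∧ f j b = 1}).ncard + ({j : ℤ | b + 2 ≤ j ∧ f b j = 1}).ncard

/-- The defect of a vertex `b`. -/
noncomputable def defect (p : ℕ) (f : ℤ → ℤ → ℝ) (b : ℤ) : ℝ :=
  f (b - 1) (b + 1) - lam p * (1 + (numArcs f b : ℝ))


/-- Chebyshev-type values `sin (k π / p) / sin (π / p)`. -/
noncomputable def sn (p : ℕ) (k : ℕ) : ℝ :=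
  Real.sin (k * (Real.pi / p)) / Real.sin (Real.pi / p)

lemma sin_th_pos (p : ℕ) (hp : 3 ≤ p) (k : ℕ) (h1 : 1 ≤ k) (h2 : k < p) :
    0 < Real.sin (k * (Real.pi / p)) := by
  have hp0 : (0 : ℝ) < p := by positivity
  have hk : (1 : ℝ) ≤ k := by exact_mod_cast h1
  have hkp : (k : ℝ) < p := by exact_mod_cast h2
  apply Real.sin_pos_of_pos_of_lt_pi
  · have := Real.pi_pos
    positivity
  · rw [mul_div_assoc', div_lt_iff₀ hp0]
    nlinarith [Real.pi_pos]

lemma sin_th1_pos (p : ℕ) (hp : 3 ≤ p) : 0 < Real.sin (Real.pi / p) := by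
  have := sin_th_pos p hp 1 le_rfl (by omega)
  simpa using this

lemma sn_zero (p : ℕ) : sn p 0 = 0 := by simp [sn]

lemma sn_one (p : ℕ) (hp : 3 ≤ p) : sn p 1 = 1 := by
  have := sin_th1_pos p hp
  simp [sn, this.ne']

lemma sn_rec (p : ℕ) (hp : 3 ≤ p) (k : ℕ) : sn p (k + 2) = lam p * sn p (k + 1) - sn p k := by
  have := sin_th1_pos p hp
  have e1 : ((k + 2 : ℕ) : ℝ) * (Real.pi / p) = (k + 1 : ℕ) * (Real.pi / p) + Real.pi / p := by
    push_cast; ring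
  have e2 : (k : ℝ) * (Real.pi / p) = (k + 1 : ℕ) * (Real.pi / p) - Real.pi / p := by
    push_cast; ring
  unfold sn lam
  rw [e1, e2, Real.sin_add, Real.sin_sub]
  ring

lemma sn_two (p : ℕ) (hp : 3 ≤ p) : sn p 2 = lam p := by
  rw [sn_rec p hp 0, sn_zero, zero_add, sn_one p hp]; ring

lemma sn_symm (p : ℕ) (hp : 3 ≤ p) (k l : ℕ) (h : k + l = p) : sn p k = sn p l := by
  unfold sn
  have hp0 : (0 : ℝ) < p := by positivity
  have : (k : ℝ) * (Real.pi / p) = Real.pi - l * (Real.pi / p) := by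
    have : (k : ℝ) = p - l := by rw [← h]; push_cast; ring
    rw [this]; field_simp
  rw [this, Real.sin_pi_sub]

lemma sn_pos (p : ℕ) (hp : 3 ≤ p) (k : ℕ) (h1 : 1 ≤ k) (h2 : k < p) : 0 < sn p k :=
  div_pos (sin_th_pos p hp k h1 h2) (sin_th1_pos p hp)

lemma sn_nonneg (p : ℕ) (hp : 3 ≤ p) (k : ℕ) (h2 : k ≤ p) : 0 ≤ sn p k := by
  rcases Nat.eq_zero_or_pos k with h | h
  · rw [h, sn_zero]
  · rcases h2.lt_or_eq with h3 | h3
    · exact (sn_pos p hp k h h3).le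
    · rw [sn_symm p hp k 0 (by omega), sn_zero]

lemma sn_gt_one (p : ℕ) (hp : 3 ≤ p) (k : ℕ) (h1 : 2 ≤ k) (h2 : k + 2 ≤ p) : 1 < sn p k := by
  have hs := sin_th1_pos p hp
  unfold sn
  rw [one_lt_div hs, ← sub_pos, Real.sin_sub_sin]
  have hp0 : (0 : ℝ) < p := by positivity
  have hk : (2 : ℝ) ≤ k := by exact_mod_cast h1
  have hkp : (k : ℝ) + 2 ≤ p := by exact_mod_cast h2
  have hpi := Real.pi_pos
  have ht : 0 < Real.pi / p := by positivity
  have hpt : (p : ℝ) * (Real.pi / p) = Real.pi := by field_simp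
  apply mul_pos
  · apply mul_pos two_pos
    apply Real.sin_pos_of_pos_of_lt_pi <;> nlinarith
  · apply Real.cos_pos_of_mem_Ioo
    constructor <;> nlinarith

lemma sn_ge_one (p : ℕ) (hp : 3 ≤ p) (k : ℕ) (h1 : 1 ≤ k) (h2 : k < p) : 1 ≤ sn p k := by
  by_cases h : k = 1
  · rw [h, sn_one p hp]
  · by_cases h' : k + 1 = p
    · rw [sn_symm p hp k 1 h', sn_one p hp]
    · exact (sn_gt_one p hp k (by omega) (by omega)).le

lemma lam_ge_one (p : ℕ) (hp : 3 ≤ p) : 1 ≤ lam p := by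
  rw [← sn_two p hp]; exact sn_ge_one p hp 2 (by omega) (by omega)

section frieze
variable {f : ℤ → ℤ → ℝ}

lemma frieze_rec_aux (hf : IsInfFrieze f) (n : ℕ) : ∀ i j : ℤ, j = i + n →
    f i (j + 2) = f j (j + 2) * f i (j + 1) - f i j := by
  obtain ⟨h0, h1, hpos, hu⟩ := hf
  induction n with
  | zero =>
    intro i j h
    have : j = i := by simpa using h
    subst this
    rw [h0, h1]; ring
  | succ n ih =>
    intro i j h
    push_cast at h
    have a := hu i (j + 1) (by omega)
    have b := hu i j (by omega)
    have c := ih (i + 1) j (by omega)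
    have hX := hpos (i + 1) (j + 1) (by omega)
    rw [show j + 1 + 1 = j + 2 by ring] at a
    apply mul_left_cancel₀ hX.ne'
    rw [c] at a
    linarith

lemma frieze_rec (hf : IsInfFrieze f) (i j : ℤ) (h : i ≤ j) :
    f i (j + 2) = f j (j + 2) * f i (j + 1) - f i j :=
  frieze_rec_aux hf (j - i).toNat i j (by omega)

lemma ptolemy_aux1 (hf : IsInfFrieze f) (n : ℕ) : ∀ i j k : ℤ, i ≤ j → k = j + n →
    f i k * f j (k + 1) = f i j + f i (k + 1) * f j k := by
  have h0 := hf.1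
  have h1 := hf.2.1
  induction n with
  | zero =>
    intro i j k hij h
    have : k = j := by simpa using h
    subst this
    rw [h0, h1]; ring
  | succ n ih =>
    intro i j k hij h
    push_cast at h
    have a := ih i j (k - 1) hij (by omega)
    have b := frieze_rec hf i (k - 1) (by omega)
    have c := frieze_rec hf j (k - 1) (by omega)
    rw [show k - 1 + 2 = k + 1 by ring, show k - 1 + 1 = k by ring] at *
    rw [b, c]
    linarith

lemma ptolemy_aux2 (hf : IsInfFrieze f) (n : ℕ) : ∀ i j k l : ℤ, i ≤ j → j ≤ k → l = k + n →
    f i k * f j l = f i j * f k l + f i l * f j k := by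
  have h0 := hf.1
  have h1 := hf.2.1
  induction n using Nat.strong_induction_on with
  | _ n ih =>
    intro i j k l hij hjk h
    rcases n with _ | _ | n
    · have : l = k := by simpa using h
      subst this
      rw [h0]; ring
    · have : l = k + 1 := by simpa using h
      subst this
      rw [h1, mul_one]
      exact ptolemy_aux1 hf (k - j).toNat i j k hij (by omega)
    · push_cast at h
      have a := ih n (by omega) i j k (l - 2) hij hjk (by omega)
      have a' := ih (n + 1) (by omega) i j k (l - 1) hij hjk (by push_cast; omega)
      have b := frieze_rec hf i (l - 2) (by omega)
      have c := frieze_rec hf j (l - 2) (by omega)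
      have d := frieze_rec hf k (l - 2) (by omega)
      rw [show l - 2 + 2 = l by ring, show l - 2 + 1 = l - 1 by ring] at *
      rw [b, c, d]
      linear_combination f (l - 2) l * a' - a

lemma ptolemy (hf : IsInfFrieze f) (i j k l : ℤ) (hij : i ≤ j) (hjk : j ≤ k) (hkl : k ≤ l) :
    f i k * f j l = f i j * f k l + f i l * f j k :=
  ptolemy_aux2 hf (l - k).toNat i j k l hij hjk (by omega)

lemma run_sn (p : ℕ) (hp : 3 ≤ p) (hf : IsInfFrieze f) (s : ℤ) (m : ℕ)
    (h : ∀ t : ℤ, s ≤ t → t + 2 ≤ s + m → f t (t + 2) = lam p) : f s (s + m) = sn p m := by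
  induction m using Nat.strong_induction_on with
  | _ m ih =>
    rcases m with _ | _ | m
    · simp [hf.1, sn_zero]
    · simp [hf.2.1, sn_one p hp]
    · have a := ih m (by omega) (fun t h1 h2 => h t h1 (by push_cast; omega))
      have b := ih (m + 1) (by omega) (fun t h1 h2 => h t h1 (by push_cast at *; omega))
      have c := frieze_rec hf s (s + m) (by omega)
      rw [h (s + m) (by omega) (by push_cast; omega)] at c
      rw [sn_rec p hp, ← a, ← b]
      push_cast
      rw [← add_assoc, ← add_assoc] at *
      convert c using 2 <;> ring_nf

/-- `s + 1, …, s + p - 2` all have quiddity entry `lam p`. -/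
def IsRun (p : ℕ) (f : ℤ → ℤ → ℝ) (s : ℤ) : Prop :=
  ∀ t : ℤ, s ≤ t → t + 3 ≤ s + p → f t (t + 2) = lam p

/-- Reindexing that skips the vertices `s + 1, …, s + p - 2`. -/
def skip (p : ℕ) (s : ℤ) (i : ℤ) : ℤ := if i ≤ s then i else i + (p - 2)

lemma skip_le {p : ℕ} {s i : ℤ} (h : i ≤ s) : skip p s i = i := if_pos h
lemma skip_gt {p : ℕ} {s i : ℤ} (h : s < i) : skip p s i = i + (p - 2) := if_neg (by omega)

lemma skip_lt {p : ℕ} (hp : 3 ≤ p) {s i j : ℤ} (h : i < j) : skip p s i < skip p s j := by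
  unfold skip; split_ifs <;> omega

lemma run_arc {p : ℕ} (hp : 3 ≤ p) (hf : IsInfFrieze f) {s : ℤ} (hs : IsRun p f s) :
    f s (s + p - 1) = 1 := by
  have := run_sn p hp hf s (p - 1) (fun t h1 h2 => hs t h1 (by omega))
  rw [sn_symm p hp (p - 1) 1 (by omega), sn_one p hp] at this
  convert this using 2; omega

lemma skip_frieze {p : ℕ} (hp : 3 ≤ p) (hf : IsInfFrieze f) {s : ℤ} (hs : IsRun p f s) :
    IsInfFrieze (fun i j => f (skip p s i) (skip p s j)) := by
  have h1 : ∀ i, f (skip p s i) (skip p s (i + 1)) = 1 := by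
    intro i
    rcases lt_trichotomy i s with h | h | h
    · rw [skip_le h.le, skip_le (by omega)]; exact hf.2.1 i
    · rw [skip_le h.le, skip_gt (by omega), h, ← run_arc hp hf hs]; congr 1; omega
    · rw [skip_gt h, skip_gt (by omega)]
      convert hf.2.1 (i + (p - 2)) using 2; omega
  refine ⟨fun i => hf.1 _, h1, fun i j h => ?_, fun i j h => ?_⟩
  · apply hf.2.2.1
    have := skip_lt hp (s := s) (show i < j by omega)
    omega
  · have a := skip_lt hp (s := s) (show i < i + 1 by omega)
    have b := skip_lt hp (s := s) (show j < j + 1 by omega)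
    have c : skip p s (i + 1) ≤ skip p s j := by
      rcases h.lt_or_eq with h | h
      · exact (skip_lt hp h).le
      · rw [h]
    have := ptolemy hf _ _ _ _ a.le c b.le
    simp only [h1] at this ⊢
    linarith

lemma skip_type {p : ℕ} (hp : 3 ≤ p) (hf : IsInfFrieze f) (hl : IsTypeLambda p f) {s : ℤ}
    (hs : IsRun p f s) : IsTypeLambda p (fun i j => f (skip p s i) (skip p s j)) := by
  have arc := run_arc hp hf hs
  have hlam := lam_ge_one p hp
  have e1 : f (s + 1) (s + p - 1) = lam p := by
    have := run_sn p hp hf (s + 1) (p - 2) (fun t h1 h2 => hs t (by omega) (by omega))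
    rw [sn_symm p hp (p - 2) 2 (by omega), sn_two p hp] at this
    convert this using 2; omega
  have e2 : f s (s + p - 2) = lam p := by
    have := run_sn p hp hf s (p - 2) (fun t h1 h2 => hs t (by omega) (by omega))
    rw [sn_symm p hp (p - 2) 2 (by omega), sn_two p hp] at this
    convert this using 2; omega
  have key : ∀ u v : ℝ, 0 < u → (∃ n : ℕ, 0 < n ∧ v = n * lam p) → v = u + lam p →
      ∃ n : ℕ, 0 < n ∧ u = n * lam p := by
    rintro u v hu ⟨n, hn, rfl⟩ h
    have : 1 < n := by
      by_contra hc
      have : n = 1 := by omega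
      subst this
      push_cast at h
      linarith
    refine ⟨n - 1, by omega, ?_⟩
    rw [Nat.cast_sub (by omega)]
    push_cast
    linarith
  intro i
  show ∃ n : ℕ, 0 < n ∧ f (skip p s i) (skip p s (i + 2)) = n * lam p
  by_cases h1 : i + 2 ≤ s
  · rw [skip_le h1, skip_le (by omega)]; exact hl i
  by_cases h2 : s < i
  · rw [skip_gt h2, skip_gt (by omega)]
    convert hl (i + (p - 2)) using 5; omega
  by_cases h3 : i = s
  · subst h3
    rw [skip_le le_rfl, skip_gt (by omega), show i + 2 + ((p : ℤ) - 2) = i + p by ring]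
    refine key _ _ (hf.2.2.1 _ _ (by omega)) (hl (i + p - 2)) ?_
    have pt := ptolemy hf i (i + p - 2) (i + p - 1) (i + p) (by omega) (by omega) (by omega)
    have q1 := hf.2.1 (i + p - 1)
    have q2 := hf.2.1 (i + p - 2)
    rw [show i + (p : ℤ) - 1 + 1 = i + p by ring] at q1
    rw [show i + (p : ℤ) - 2 + 1 = i + p - 1 by ring] at q2
    rw [arc, e2, q1, q2] at pt
    rw [show i + (p : ℤ) - 2 + 2 = i + p by ring]
    linarith
  · have h4 : i = s - 1 := by omega
    subst h4
    rw [skip_le (by omega), skip_gt (by omega), show s - 1 + 2 + ((p : ℤ) - 2) = s + p - 1 by ring]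
    refine key _ _ (hf.2.2.1 _ _ (by omega)) (hl (s - 1)) ?_
    have pt := ptolemy hf (s - 1) s (s + 1) (s + p - 1) (by omega) (by omega) (by omega)
    have q1 := hf.2.1 (s - 1)
    rw [show s - 1 + 1 = s by ring] at q1
    rw [arc, e1, q1, hf.2.1 s] at pt
    rw [show s - 1 + 2 = s + 1 by ring]
    linarith

/-- Invariant in the run-free region. -/
def RunInv (p : ℕ) (f : ℤ → ℤ → ℝ) (i j : ℤ) : Prop :=
  ∃ m : ℕ, m + 3 ≤ p ∧ i + m + 1 ≤ j ∧ (∀ t : ℤ, j ≤ t + m + 1 → t + 2 ≤ j → f t (t + 2) = lam p) ∧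
    ((j = i + m + 1 ∧ f i j = sn p (m + 1) ∧ f i (j - 1) = sn p m) ∨
     (f i (j - 1) * sn p (m + 2) < f i j * sn p (m + 1) ∧ sn p (m + 2) < f i j))

lemma inv_gt (p : ℕ) (hp : 3 ≤ p) (i j : ℤ) (h : i + 2 ≤ j) (H : RunInv p f i j) : 1 < f i j := by
  obtain ⟨m, hm, _, _, (⟨h1, h2, _⟩ | ⟨_, h2⟩)⟩ := H
  · rw [h2]; exact sn_gt_one p hp _ (by omega) (by omega)
  · exact lt_of_le_of_lt (sn_ge_one p hp _ (by omega) (by omega)) h2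

lemma inv_step (p : ℕ) (hp : 3 ≤ p) (hf : IsInfFrieze f) (hl : IsTypeLambda p f) (i j : ℤ)
    (hij : i + 1 ≤ j) (hrun : ∀ s, i ≤ s → s + p - 1 ≤ j + 1 → ¬ IsRun p f s)
    (H : RunInv p f i j) : RunInv p f i (j + 1) := by
  have hge : 1 ≤ f i j := by
    rcases hij.lt_or_eq with h | h
    · exact (inv_gt p hp i j (by omega) H).le
    · rw [← h, hf.2.1]
  have hlam := lam_ge_one p hp
  obtain ⟨m, hm, hjm, hr, H⟩ := H
  have rc := frieze_rec hf i (j - 1) (by omega)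
  rw [show j - 1 + 2 = j + 1 by ring, show j - 1 + 1 = j by ring] at rc
  have sr := sn_rec p hp m
  have sr1 := sn_rec p hp (m + 1)
  have p1 := sn_pos p hp (m + 1) (by omega) (by omega)
  have p2 := sn_pos p hp (m + 2) (by omega) (by omega)
  have p3 := sn_nonneg p hp (m + 3) (by omega)
  have p0 := sn_nonneg p hp m (by omega)
  by_cases hc : f (j - 1) (j + 1) = lam p
  · -- extend the run
    have hr' : ∀ t : ℤ, j + 1 ≤ t + (m + 1 : ℕ) + 1 → t + 2 ≤ j + 1 → f t (t + 2) = lam p := by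
      intro t h1 h2
      push_cast at h1
      by_cases h3 : t + 2 ≤ j
      · exact hr t (by omega) h3
      · have : t = j - 1 := by omega
        subst this
        rw [show j - 1 + 2 = j + 1 by ring]; exact hc
    have hm' : m + 1 + 3 ≤ p := by
      by_contra hcon
      have : m + 3 = p := by omega
      refine hrun (j - m - 1) (by omega) (by omega) fun t h1 h2 => hr' t ?_ ?_
      · push_cast; omega
      · omega
    refine ⟨m + 1, hm', by push_cast; omega, hr', ?_⟩
    rw [hc] at rc
    rw [show j + 1 - 1 = j by ring, rc]
    rcases H with ⟨h1, h2, h3⟩ | ⟨h1, h2⟩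
    · left
      refine ⟨by push_cast; omega, ?_, h2⟩
      rw [h2, h3]; exact sr.symm
    · right
      have w : f i j * sn p (m + 1 + 2) < (lam p * f i j - f i (j - 1)) * sn p (m + 1 + 1) := by
        rw [sr1]; linarith
      refine ⟨w, ?_⟩
      have : sn p (m + 1 + 2) * sn p (m + 2) ≤ f i j * sn p (m + 1 + 2) := by
        rw [mul_comm]; exact mul_le_mul_of_nonneg_right h2.le p3
      exact lt_of_mul_lt_mul_right (lt_of_le_of_lt this w) p2.le
  · -- reset
    have hc2 : 2 * lam p ≤ f (j - 1) (j + 1) := by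
      obtain ⟨n, hn, e⟩ := hl (j - 1)
      rw [show j - 1 + 2 = j + 1 by ring] at e
      have : n ≠ 1 := by rintro rfl; apply hc; rw [e]; simp
      have : (2 : ℝ) ≤ n := by exact_mod_cast (by omega : 2 ≤ n)
      rw [e]; nlinarith
    have hlt : f i (j - 1) < lam p * f i j := by
      rcases H with ⟨h1, h2, h3⟩ | ⟨h1, h2⟩
      · rw [h2, h3]; linarith
      · have : f i j * sn p (m + 1) ≤ lam p * f i j * sn p (m + 2) := by
          have : 0 ≤ f i j * sn p (m + 3) := by positivity
          rw [sr1] at this; linarith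
        exact lt_of_mul_lt_mul_right (lt_of_lt_of_le h1 this) p2.le
    have hbig : lam p * f i j < f i (j + 1) := by
      rw [rc]
      have : 2 * lam p * f i j ≤ f (j - 1) (j + 1) * f i j :=
        mul_le_mul_of_nonneg_right hc2 (by linarith)
      linarith
    refine ⟨0, by omega, by push_cast; omega, fun t h1 h2 => ?_, Or.inr ?_⟩
    · push_cast at h1; omega
    · rw [zero_add, zero_add, sn_two p hp, sn_one p hp, show j + 1 - 1 = j by ring]
      constructor
      · linarith
      · nlinarith

lemma inv_all (p : ℕ) (hp : 3 ≤ p) (hf : IsInfFrieze f) (hl : IsTypeLambda p f) (i : ℤ) (n : ℕ)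
    (hrun : ∀ s, i ≤ s → s + p - 1 ≤ i + 1 + n → ¬ IsRun p f s) : RunInv p f i (i + 1 + n) := by
  induction n with
  | zero =>
    refine ⟨0, by omega, by push_cast; omega, fun t h1 h2 => ?_, Or.inl ⟨by simp, ?_, ?_⟩⟩
    · push_cast at *; omega
    · simp [hf.2.1, sn_one p hp]
    · simp [hf.1, sn_zero]
  | succ n ih =>
    have := inv_step p hp hf hl i (i + 1 + n) (by omega)
      (fun s h1 h2 => hrun s h1 (by push_cast; omega))
      (ih (fun s h1 h2 => hrun s h1 (by push_cast; omega)))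
    push_cast
    rwa [← add_assoc]

lemma no_run_gt (p : ℕ) (hp : 3 ≤ p) (hf : IsInfFrieze f) (hl : IsTypeLambda p f) (i j : ℤ)
    (hij : i + 2 ≤ j) (hrun : ∀ s, i ≤ s → s + p - 1 ≤ j → ¬ IsRun p f s) : 1 < f i j := by
  obtain ⟨n, hn⟩ : ∃ n : ℕ, j = i + 1 + n := ⟨(j - i - 1).toNat, by omega⟩
  subst hn
  exact inv_gt p hp _ _ hij (inv_all p hp hf hl i n hrun)

end frieze

lemma ge_one_aux (p : ℕ) (hp : 3 ≤ p) (n : ℕ) : ∀ (f : ℤ → ℤ → ℝ), IsInfFrieze f →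
    IsTypeLambda p f → ∀ i j : ℤ, i < j → j ≤ i + n → 1 ≤ f i j := by
  induction n with
  | zero => intro f _ _ i j h1 h2; simp at h2; omega
  | succ n ih =>
    intro f hf hl i j h1 h2
    push_cast at h2
    by_cases h : j = i + 1
    · rw [h, hf.2.1]
    by_cases hr : ∃ s, i ≤ s ∧ s + p - 1 ≤ j ∧ IsRun p f s
    · obtain ⟨s, hs1, hs2, hs⟩ := hr
      have := ih _ (skip_frieze hp hf hs) (skip_type hp hf hl hs) i (j - (p - 2))
        (by omega) (by omega)
      rw [skip_le hs1, skip_gt (by omega)] at this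
      simpa using this
    · push Not at hr
      exact (no_run_gt p hp hf hl i j (by omega) hr).le

section frieze2
variable {f : ℤ → ℤ → ℝ}

lemma ge_one {p : ℕ} (hp : 3 ≤ p) (hf : IsInfFrieze f) (hl : IsTypeLambda p f) (i j : ℤ)
    (h : i < j) : 1 ≤ f i j :=
  ge_one_aux p hp (j - i).toNat f hf hl i j h (by omega)

lemma noncross {p : ℕ} (hp : 3 ≤ p) (hf : IsInfFrieze f) (hl : IsTypeLambda p f) {i j k l : ℤ}
    (h1 : i < j) (h2 : j < k) (h3 : k < l) (e1 : f i k = 1) (e2 : f j l = 1) : False := by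
  have pt := ptolemy hf i j k l h1.le h2.le h3.le
  have a := ge_one hp hf hl i j h1
  have b := ge_one hp hf hl k l h3
  have c := ge_one hp hf hl i l (by omega)
  have d := ge_one hp hf hl j k h2
  rw [e1, e2] at pt
  nlinarith

lemma fan_add (hf : IsInfFrieze f) {b d e d' : ℤ} (h0 : b ≤ d) (h1 : d ≤ e) (h2 : e ≤ d')
    (e1 : f b d = 1) (e2 : f b e = 1) (e3 : f b d' = 1) : f d d' = f d e + f e d' := by
  have pt := ptolemy hf b d e d' h0 h1 h2
  rw [e1, e2, e3] at pt
  linarith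

end frieze2

lemma fan_aux (p : ℕ) (hp : 3 ≤ p) (n : ℕ) : ∀ (f : ℤ → ℤ → ℝ), IsInfFrieze f →
    IsTypeLambda p f → ∀ b d d' : ℤ, b < d → d < d' → d' ≤ b + n → f b d = 1 → f b d' = 1 →
    lam p ≤ f d d' := by
  induction n with
  | zero => intro f _ _ b d d' h1 h2 h3; simp at h3; omega
  | succ n ih =>
    intro f hf hl b d d' h1 h2 h3 e1 e2
    push_cast at h3
    have hr : ∃ s, b ≤ s ∧ s + p - 1 ≤ d' ∧ IsRun p f s := by
      by_contra hr
      push Not at hr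
      have := no_run_gt p hp hf hl b d' (by omega) hr
      linarith
    obtain ⟨s, hs1, hs2, hs⟩ := hr
    have arc := run_arc hp hf hs
    have IH := ih _ (skip_frieze hp hf hs) (skip_type hp hf hl hs)
    beta_reduce at IH
    by_cases c1 : d ≤ s
    · have := IH b d (d' - (p - 2)) h1 (by omega) (by omega)
      rw [skip_le hs1, skip_le c1, skip_gt (by omega)] at this
      simp only [sub_add_cancel] at this
      exact this e1 e2
    by_cases c2 : s + p - 1 ≤ d
    · have := IH b (d - (p - 2)) (d' - (p - 2)) (by omega) (by omega) (by omega)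
      rw [skip_le hs1, skip_gt (by omega), skip_gt (by omega)] at this
      simp only [sub_add_cancel] at this
      exact this e1 e2
    rcases hs1.lt_or_eq with c3 | c3
    · exact (noncross hp hf hl c3 (by omega : s < d) (by omega : d < s + p - 1) e1 arc).elim
    subst c3
    obtain ⟨k, hk⟩ : ∃ k : ℕ, d = b + k := ⟨(d - b).toNat, by omega⟩
    have q := run_sn p hp hf b k (fun t a1 a2 => hs t a1 (by omega))
    have hk1 : k = 1 := by
      by_contra hne
      have := sn_gt_one p hp k (by omega) (by omega)
      rw [← q, ← hk] at this
      linarith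
    subst hk1
    have q2 : f d (b + p - 1) = lam p := by
      have := run_sn p hp hf d (p - 2) (fun t h1 h2 => hs t (by omega) (by omega))
      rw [sn_symm p hp (p - 2) 2 (by omega), sn_two p hp] at this
      convert this using 2; omega
    have := fan_add hf h1.le (by omega : d ≤ b + p - 1) hs2 e1 arc e2
    rw [this, q2]
    have : 0 ≤ f (b + p - 1) d' := by
      rcases hs2.lt_or_eq with c | c
      · exact (hf.2.2.1 _ _ (by omega)).le
      · rw [c, hf.1]
    linarith

section frieze3
variable {f : ℤ → ℤ → ℝ}

lemma fan {p : ℕ} (hp : 3 ≤ p) (hf : IsInfFrieze f) (hl : IsTypeLambda p f) {b d d' : ℤ}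
    (h1 : b < d) (h2 : d < d') (e1 : f b d = 1) (e2 : f b d' = 1) : lam p ≤ f d d' :=
  fan_aux p hp (d' - b).toNat f hf hl b d d' h1 h2 (by omega) e1 e2

open Classical in
lemma fan_count {p : ℕ} (hp : 3 ≤ p) (hf : IsInfFrieze f) (hl : IsTypeLambda p f) (b : ℤ)
    (S : Finset ℤ) : (∀ j ∈ S, b + 2 ≤ j ∧ f b j = 1) → ∀ d, b + 1 ≤ d → f b d = 1 →
    (∀ j ∈ S, j ≤ d) → lam p * S.card ≤ f (b + 1) d := by
  have hlam := lam_ge_one p hp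
  have h1 := hf.2.1 b
  induction S using Finset.induction_on_max with
  | empty =>
    intro _ d hd _ _
    simp only [Finset.card_empty, Nat.cast_zero, mul_zero]
    rcases hd.lt_or_eq with c | c
    · exact (hf.2.2.1 _ _ (by omega)).le
    · rw [c, hf.1]
  | insert a S ha ih =>
    intro hS d hd e hle
    obtain ⟨a2, ae⟩ := hS a (Finset.mem_insert_self _ _)
    have had := hle a (Finset.mem_insert_self _ _)
    have hna : a ∉ S := fun h => lt_irrefl _ (ha a h)
    rw [Finset.card_insert_of_notMem hna]
    push_cast
    have mono : f (b + 1) a ≤ f (b + 1) d := by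
      rw [fan_add hf (by omega : b ≤ b + 1) (by omega : b + 1 ≤ a) had h1 ae e]
      rcases had.lt_or_eq with c | c
      · linarith [hf.2.2.1 a d (by omega)]
      · rw [c, hf.1]; linarith
    refine le_trans ?_ mono
    -- previous arc
    obtain ⟨d0, hd0, hd0a, e0, hmax⟩ : ∃ d0, b + 1 ≤ d0 ∧ d0 < a ∧ f b d0 = 1 ∧ ∀ j ∈ S, j ≤ d0 := by
      rcases S.eq_empty_or_nonempty with h | h
      · exact ⟨b + 1, le_rfl, by omega, h1, by simp [h]⟩
      · have hm := S.max'_mem h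
        obtain ⟨u, v⟩ := hS _ (Finset.mem_insert_of_mem hm)
        exact ⟨S.max' h, by omega, ha _ hm, v, fun j hj => S.le_max' j hj⟩
    have I := ih (fun j hj => hS j (Finset.mem_insert_of_mem hj)) d0 hd0 e0 hmax
    rw [fan_add hf (by omega : b ≤ b + 1) hd0 hd0a.le h1 e0 ae]
    have := fan hp hf hl (by omega : b < d0) hd0a e0 ae
    linarith

lemma right_data {p : ℕ} (hp : 3 ≤ p) (hf : IsInfFrieze f) (hl : IsTypeLambda p f) (b : ℤ) :
    ∃ R, b + 1 ≤ R ∧ f b R = 1 ∧ (∀ j, b < j → f b j = 1 → j ≤ R) ∧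
      lam p * (({j : ℤ | b + 2 ≤ j ∧ f b j = 1}).ncard : ℝ) ≤ f (b + 1) R := by
  have hlam := lam_ge_one p hp
  have h1 := hf.2.1 b
  have hfin : ({j : ℤ | b + 2 ≤ j ∧ f b j = 1}).Finite := by
    by_contra hinf
    obtain ⟨N, hN⟩ := exists_nat_gt (f (b - 1) (b + 1))
    obtain ⟨S, hS, hc⟩ := Set.Infinite.exists_subset_card_eq hinf (N + 1)
    have hne : S.Nonempty := by rw [← Finset.card_pos]; omega
    have hm := hS (S.max'_mem hne)
    have := fan_count hp hf hl b S (fun j hj => hS hj) (S.max' hne) (by have := hm.1; omega) hm.2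
      (fun j hj => S.le_max' j hj)
    have pt := ptolemy hf (b - 1) b (b + 1) (S.max' hne) (by omega) (by omega)
      (by have := hm.1; omega)
    have q := hf.2.1 (b - 1)
    rw [sub_add_cancel] at q
    rw [q, h1, hm.2] at pt
    have := hf.2.2.1 (b - 1) (S.max' hne) (by have := hm.1; omega)
    rw [hc] at *
    push_cast at *
    nlinarith
  set A := hfin.toFinset with hA
  have hAmem : ∀ j, j ∈ A ↔ b + 2 ≤ j ∧ f b j = 1 := by intro j; simp [hA]
  rw [Set.ncard_eq_toFinset_card _ hfin]
  obtain ⟨R, hR, eR, hmax⟩ : ∃ R, b + 1 ≤ R ∧ f b R = 1 ∧ ∀ j ∈ A, j ≤ R := by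
    rcases A.eq_empty_or_nonempty with h | h
    · exact ⟨b + 1, le_rfl, h1, by simp [h]⟩
    · have hm := (hAmem _).1 (A.max'_mem h)
      exact ⟨A.max' h, by omega, hm.2, fun j hj => A.le_max' j hj⟩
  refine ⟨R, hR, eR, fun j hj e => ?_, fan_count hp hf hl b A (fun j hj => (hAmem j).1 hj) R hR eR hmax⟩
  by_cases h : b + 2 ≤ j
  · exact hmax j ((hAmem j).2 ⟨h, e⟩)
  · omega

lemma mirror_frieze (hf : IsInfFrieze f) : IsInfFrieze (fun i j => f (-j) (-i)) := by
  refine ⟨fun i => hf.1 _, fun i => ?_, fun i j h => hf.2.2.1 _ _ (by omega), fun i j h => ?_⟩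
  · have := hf.2.1 (-(i + 1))
    rwa [show -(i + 1) + 1 = -i by ring] at this
  · have := hf.2.2.2 (-(j + 1)) (-(i + 1)) (by omega)
    rw [show -(i + 1) + 1 = -i by ring, show -(j + 1) + 1 = -j by ring] at this
    show f (-j) (-i) * f (-(j + 1)) (-(i + 1)) - f (-(j + 1)) (-i) * f (-j) (-(i + 1)) = 1
    linarith

lemma mirror_type {p : ℕ} (hl : IsTypeLambda p f) : IsTypeLambda p (fun i j => f (-j) (-i)) := by
  intro i
  have := hl (-(i + 2))
  rwa [show -(i + 2) + 2 = -i by ring] at this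

lemma left_data {p : ℕ} (hp : 3 ≤ p) (hf : IsInfFrieze f) (hl : IsTypeLambda p f) (b : ℤ) :
    ∃ L, L ≤ b - 1 ∧ f L b = 1 ∧ (∀ j, j < b → f j b = 1 → L ≤ j) ∧
      lam p * (({j : ℤ | j ≤ b - 2 ∧ f j b = 1}).ncard : ℝ) ≤ f L (b - 1) := by
  obtain ⟨R, h1, h2, h3, h4⟩ := right_data hp (mirror_frieze hf) (mirror_type hl) (-b)
  simp only [neg_neg] at h2 h3 h4
  refine ⟨-R, by omega, h2, fun j hj e => ?_, ?_⟩
  · have := h3 (-j) (by omega) (by rwa [neg_neg]); omega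
  · rw [show -(-b + 1) = b - 1 by ring] at h4
    have : {j : ℤ | j ≤ b - 2 ∧ f j b = 1} = Neg.neg '' {j : ℤ | -b + 2 ≤ j ∧ f (-j) b = 1} := by
      ext j
      simp only [Set.mem_ofPred_eq, Set.image_neg_eq_neg, Set.mem_neg, neg_neg]
      constructor <;> rintro ⟨a, c⟩ <;> exact ⟨by omega, c⟩
    rw [this, Set.ncard_image_of_injective _ neg_injective]
    exact h4

lemma local_data {p : ℕ} (hp : 3 ≤ p) (hf : IsInfFrieze f) (hl : IsTypeLambda p f) (b : ℤ)
    (hd : defect p f b = 0) :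
    ∃ L R, L < b ∧ b < R ∧ f L b = 1 ∧ f b R = 1 ∧ (∀ j, j < b → f j b = 1 → L ≤ j) ∧
      (∀ j, b < j → f b j = 1 → j ≤ R) ∧ f L R ≤ lam p := by
  obtain ⟨R, r1, r2, r3, r4⟩ := right_data hp hf hl b
  obtain ⟨L, l1, l2, l3, l4⟩ := left_data hp hf hl b
  refine ⟨L, R, by omega, by omega, l2, r2, l3, r3, ?_⟩
  unfold defect numArcs at hd
  push_cast at hd
  have pt := ptolemy hf L b (b + 1) R (by omega) (by omega) r1
  have pt2 := ptolemy hf L (b - 1) b (b + 1) l1 (by omega) (by omega)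
  have q := hf.2.1 (b - 1)
  rw [sub_add_cancel] at q
  rw [l2, r2, hf.2.1 b] at pt
  rw [l2, q, hf.2.1 b] at pt2
  linarith

lemma gap_arc {p : ℕ} (hp : 3 ≤ p) (hf : IsInfFrieze f) (hl : IsTypeLambda p f) {a b : ℤ}
    (hab : a < b) (ha : ¬ Saturated f a) (hb : ¬ Saturated f b)
    (hs : ∀ c, a < c → c < b → Saturated f c) : f a b = 1 := by
  classical
  set A := (Finset.Icc (a + 1) b).filter (fun j => f a j = 1) with hA
  have hmem : ∀ j, j ∈ A ↔ (a + 1 ≤ j ∧ j ≤ b) ∧ f a j = 1 := by intro j; simp [hA]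
  have hne : A.Nonempty := ⟨a + 1, (hmem _).2 ⟨⟨le_rfl, by omega⟩, hf.2.1 a⟩⟩
  obtain ⟨⟨m1, m2⟩, m3⟩ := (hmem _).1 (A.max'_mem hne)
  have hmax : ∀ j ∈ A, j ≤ A.max' hne := fun j hj => A.le_max' j hj
  generalize A.max' hne = j at *
  rcases m2.lt_or_eq with c | c
  · exfalso
    obtain ⟨u, v, hu, hv, e⟩ := hs j (by omega) c
    have hvb : v ≤ b := by
      by_contra h
      exact hb ⟨u, v, by omega, by omega, e⟩
    rcases lt_trichotomy u a with h | h | h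
    · exact ha ⟨u, v, h, by omega, e⟩
    · subst h
      have := hmax v ((hmem v).2 ⟨⟨by omega, hvb⟩, e⟩)
      omega
    · exact noncross hp hf hl h hu hv m3 e
  · rw [← c]; exact m3

end frieze3

/-- At most `p - 3` consecutive non-saturated vertices can have defect `0`. -/
theorem infFrieze_consecutive_nonsaturated (p : ℕ) (hp : 3 ≤ p) (f : ℤ → ℤ → ℝ)
    (hf : IsInfFrieze f) (hl : IsTypeLambda p f)
    (r : ℕ) (hr : 1 ≤ r) (x : Fin r → ℤ) (hmono : StrictMono x)
    (hnonsat : ∀ k : Fin r, ¬ Saturated f (x k))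
    (hdef : ∀ k : Fin r, defect p f (x k) = 0)
    (hconsec : ∀ b : ℤ, x ⟨0, by omega⟩ < b → b < x ⟨r - 1, by omega⟩ →
      ¬ Saturated f b → ∃ k : Fin r, b = x k) :
    r ≤ p - 3 := by
  by_contra hcon
  have hrp : p ≤ r + 2 := by omega
  choose L R hL hR eL eR mL mR hLR using fun k => local_data hp hf hl (x k) (hdef k)
  -- consecutive vertices are joined by arcs
  have hgap : ∀ k (hk : k + 1 < r), f (x ⟨k, by omega⟩) (x ⟨k + 1, hk⟩) = 1 := by
    intro k hk
    refine gap_arc hp hf hl (hmono (by simp)) (hnonsat _) (hnonsat _) fun c h1 h2 => ?_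
    by_contra hc
    obtain ⟨j, rfl⟩ := hconsec c
      (lt_of_le_of_lt (hmono.monotone (by simp [Fin.le_def])) h1)
      (lt_of_lt_of_le h2 (hmono.monotone (by simp only [Fin.le_def]; omega))) hc
    have a1 := hmono.lt_iff_lt.1 h1
    have a2 := hmono.lt_iff_lt.1 h2
    simp only [Fin.lt_def] at a1 a2
    omega
  have hlt : ∀ k (hk : k + 1 < r), x ⟨k, by omega⟩ < x ⟨k + 1, hk⟩ :=
    fun k hk => hmono (by simp)
  have hRx : ∀ k (hk : k + 1 < r), R ⟨k, by omega⟩ = x ⟨k + 1, hk⟩ := by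
    intro k hk
    have h1 := mR ⟨k, by omega⟩ _ (hlt k hk) (hgap k hk)
    rcases h1.lt_or_eq with h | h
    · exact (hnonsat ⟨k + 1, hk⟩ ⟨_, _, hlt k hk, h, eR _⟩).elim
    · exact h.symm
  have hLx : ∀ k (hk : k + 1 < r), L ⟨k + 1, hk⟩ = x ⟨k, by omega⟩ := by
    intro k hk
    have h1 := mL ⟨k + 1, hk⟩ _ (hlt k hk) (hgap k hk)
    rcases h1.lt_or_eq with h | h
    · exact (hnonsat ⟨k, by omega⟩ ⟨_, _, h, hlt k hk, eL _⟩).elim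
    · exact h
  set ℓ := L ⟨0, by omega⟩ with hℓ
  have hx0 : ∀ k (hk : k < r), x ⟨0, by omega⟩ ≤ x ⟨k, hk⟩ :=
    fun k hk => hmono.monotone (by simp [Fin.le_def])
  have hℓ0 : ℓ < x ⟨0, by omega⟩ := hL _
  have main : ∀ k (hk : k + 2 < p), f ℓ (x ⟨k, by omega⟩) ≤ sn p (k + 1) ∧
      f ℓ (R ⟨k, by omega⟩) * sn p (k + 1) ≤ f ℓ (x ⟨k, by omega⟩) * sn p (k + 2) := by
    intro k
    induction k with
    | zero =>
      intro hk
      rw [zero_add, zero_add, sn_one p hp, sn_two p hp, eL ⟨0, by omega⟩]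
      exact ⟨le_rfl, by linarith [hLR ⟨0, by omega⟩]⟩
    | succ k ih =>
      intro hk
      have hkr : k + 1 < r := by omega
      obtain ⟨i1, i2⟩ := ih (by omega)
      rw [hRx k hkr] at i2
      have p1 := sn_pos p hp (k + 1) (by omega) (by omega)
      have p2 := sn_pos p hp (k + 2) (by omega) (by omega)
      constructor
      · have : f ℓ (x ⟨k, by omega⟩) * sn p (k + 2) ≤ sn p (k + 1) * sn p (k + 2) :=
          mul_le_mul_of_nonneg_right i1 p2.le
        refine le_of_mul_le_mul_right (i2.trans ?_) p1
        rw [mul_comm (sn p (k + 1 + 1))]; exact this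
      · have pt := ptolemy hf ℓ (x ⟨k, by omega⟩) (x ⟨k + 1, hkr⟩) (R ⟨k + 1, hkr⟩)
          (by have := hx0 k (by omega); omega) (hlt k hkr).le (hR _).le
        rw [eR, hgap k hkr] at pt
        have h3 := hLR ⟨k + 1, hkr⟩
        rw [hLx k hkr] at h3
        have hpos : 0 < f ℓ (x ⟨k + 1, hkr⟩) :=
          hf.2.2.1 _ _ (by have := hx0 (k + 1) hkr; omega)
        have h4 := mul_le_mul_of_nonneg_left h3 hpos.le
        have h5 : f ℓ (R ⟨k + 1, hkr⟩) ≤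
            f ℓ (x ⟨k + 1, hkr⟩) * lam p - f ℓ (x ⟨k, by omega⟩) := by linarith
        have h6 := mul_le_mul_of_nonneg_right h5 p2.le
        have sr := sn_rec p hp (k + 1)
        rw [show k + 1 + 2 = k + 1 + 2 from rfl, sr]
        rw [show k + 1 + 1 = k + 2 by ring]
        linarith
  obtain ⟨q, rfl⟩ : ∃ q, p = q + 3 := ⟨p - 3, by omega⟩
  obtain ⟨i1, i2⟩ := main q (by omega)
  have p1 := sn_pos (q + 3) hp (q + 1) (by omega) (by omega)
  rw [sn_symm (q + 3) hp (q + 2) 1 (by omega), sn_one _ hp, mul_one] at i2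
  have hle : f ℓ (R ⟨q, by omega⟩) ≤ 1 := by
    refine le_of_mul_le_mul_right ?_ p1
    linarith
  have hR0 : x ⟨0, by omega⟩ < R ⟨q, by omega⟩ := lt_of_le_of_lt (hx0 q (by omega)) (hR _)
  have hge := ge_one hp hf hl ℓ (R ⟨q, by omega⟩) (by omega)
  exact hnonsat ⟨0, by omega⟩ ⟨_, _, hℓ0, hR0, le_antisymm hle hge⟩
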